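/- Main Theorem: Let R be a countable principal ideal domain which is not a field, and A an R-algebra which is free as an R-module with |A| < λ ≤ 2^{ℵ₀}. Then there exists an R-module G of cardinality λ such that every countably generated R-submodule of G is free (G is ℵ₁-free) and End_R(G) = A, where A acts by scalar multiplication. -/

import Mathlib

/-- A module embedded in a free module over a PID is free. -/
theorem GS_free_sub {R ι M : Type} [CommRing R] [IsDomain R] [IsPrincipalIdealRing R]
    [AddCommGroup M] [Module R M] (f : M →ₗ[R] (ι →₀ R)) (hf : Function.Injective f) :
    Module.Free R M := by
  classical
  let _ : LinearOrder ι := linearOrderOfSTO WellOrderingRel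
  have wf : WellFounded (fun a b : ι => a < b) :=
    (inferInstance : IsWellFounded ι WellOrderingRel).wf
  let I : ι → Ideal R := fun i =>
    { carrier := {r | ∃ x : M, f x i = r ∧ ∀ j, i < j → f x j = 0}
      add_mem' := by
        rintro a b ⟨x, rfl, hx'⟩ ⟨y, rfl, hy'⟩
        exact ⟨x + y, by simp, fun j hj => by simp [hx' j hj, hy' j hj]⟩
      zero_mem' := ⟨0, by simp, fun j hj => by simp⟩
      smul_mem' := by
        rintro c a ⟨x, rfl, hx'⟩
        exact ⟨c • x, by simp, fun j hj => by simp [hx' j hj]⟩ }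
  have hg : ∀ i, ∃ x : M, f x i = Submodule.IsPrincipal.generator (I i) ∧
      ∀ j, i < j → f x j = 0 :=
    fun i => Submodule.IsPrincipal.generator_mem (I i)
  choose X hXi hXj using hg
  let S := {i // f (X i) i ≠ 0}
  let v : S → M := fun i => X i.1
  have hli : LinearIndependent R v := by
    rw [linearIndependent_iff]
    intro l hl
    by_contra hne
    have hs : l.support.Nonempty := Finsupp.support_nonempty_iff.mpr hne
    have hm := l.support.max'_mem hs
    set m := l.support.max' hs with hmdef
    have h1 : f (Finsupp.linearCombination R v l) m.1 = 0 := by rw [hl]; simp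
    rw [Finsupp.linearCombination_apply, Finsupp.sum, map_sum, Finsupp.finsetSum_apply,
      Finset.sum_eq_single m] at h1
    · have : l m * f (X m.1) m.1 = 0 := by simpa [v] using h1
      rcases mul_eq_zero.mp this with h | h
      · exact (Finsupp.mem_support_iff.mp hm) h
      · exact m.2 h
    · intro j hj hjm
      have hlt : j < m := lt_of_le_of_ne (Finset.le_max' _ _ hj) hjm
      have : f (X j.1) m.1 = 0 := hXj _ _ hlt
      simp [v, this]
    · intro h; exact absurd hm h
  have hsp : ∀ i, ∀ x : M, (∀ j, i < j → f x j = 0) → x ∈ Submodule.span R (Set.range v) := by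
    intro i
    induction i using wf.induction with
    | _ i ih =>
    intro x hx
    have h1 : ∃ c : R, ∃ y ∈ Submodule.span R (Set.range v),
        ∀ j, i ≤ j → f (x - c • y) j = 0 := by
      have hmem : f x i ∈ I i := ⟨x, rfl, hx⟩
      obtain ⟨c, hc⟩ := (Submodule.IsPrincipal.mem_iff_eq_smul_generator (I i)).mp hmem
      rw [← hXi] at hc
      by_cases h0 : f (X i) i = 0
      · refine ⟨0, 0, Submodule.zero_mem _, fun j hj => ?_⟩
        rcases hj.eq_or_lt with rfl | hj
        · simp [hc, h0]
        · simp [hx j hj]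
      · refine ⟨c, v ⟨i, h0⟩, Submodule.subset_span ⟨_, rfl⟩, fun j hj => ?_⟩
        rcases hj.eq_or_lt with rfl | hj
        · simp [hc, v]
        · simp [v, hx j hj, hXj _ _ hj]
    obtain ⟨c, y, hy, hz⟩ := h1
    have h2 : x - c • y ∈ Submodule.span R (Set.range v) := by
      by_cases h0 : f (x - c • y) = 0
      · have : x - c • y = 0 := hf (by rw [h0, map_zero])
        rw [this]; exact Submodule.zero_mem _
      · have hs : (f (x - c • y)).support.Nonempty := Finsupp.support_nonempty_iff.mpr h0
        refine ih ((f (x - c • y)).support.max' hs) ?_ _ ?_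
        · have := Finset.max'_mem _ hs
          rw [Finsupp.mem_support_iff] at this
          by_contra hle
          exact this (hz _ (not_lt.mp hle))
        · intro j hj
          by_contra hne
          exact absurd (Finset.le_max' _ j (Finsupp.mem_support_iff.mpr hne)) (not_le.mpr hj)
    have := Submodule.add_mem _ h2 (Submodule.smul_mem _ c hy)
    rwa [sub_add_cancel] at this
  have htop : ⊤ ≤ Submodule.span R (Set.range v) := by
    rintro x -
    by_cases h0 : f x = 0
    · have : x = 0 := hf (by rw [h0, map_zero])
      rw [this]; exact Submodule.zero_mem _
    · have hs : (f x).support.Nonempty := Finsupp.support_nonempty_iff.mpr h0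
      refine hsp ((f x).support.max' hs) x fun j hj => ?_
      by_contra hne
      exact absurd (Finset.le_max' _ j (Finsupp.mem_support_iff.mpr hne)) (not_le.mpr hj)
  exact Module.Free.of_basis (Module.Basis.mk hli htop)

theorem GS_free_inj {R M F : Type} [CommRing R] [IsDomain R] [IsPrincipalIdealRing R]
    [AddCommGroup M] [Module R M] [AddCommGroup F] [Module R F] [Module.Free R F]
    (f : M →ₗ[R] F) (hf : Function.Injective f) : Module.Free R M :=
  GS_free_sub ((Module.Free.chooseBasis R F).repr.toLinearMap ∘ₗ f)
    ((Module.Free.chooseBasis R F).repr.injective.comp hf)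

/-- The combinatorial and algebraic data used in the construction. -/
structure GSData (R A J X Z Q : Type) [CommRing R] [Ring A] [Algebra R A]
    [AddCommGroup Q] [Module R Q] [Module A Q] [IsScalarTower R A Q] where
  p : R
  node : Z → ℕ → X
  len : X → ℕ
  al : Z → J
  ep : Z → ℕ → Bool
  S : J → Set ℕ
  g : J → (X →₀ A)
  cs : (X →₀ A) →ₗ[A] Q
  y : Z → ℕ → Q
  len_node : ∀ z n, len (node z n) = n
  node_al : ∀ z w n, node z n = node w n → al z = al w
  node_mono : ∀ z w m n, m ≤ n → node z n = node w n → node z m = node w m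
  node_sep : ∀ z w, z ≠ w → ∃ n, node z n ≠ node w n
  node_succ : ∀ z w n, node z n = node w n → ep z n = ep w n → node z (n + 1) = node w (n + 1)
  node_ep : ∀ z w n, node z (n + 1) = node w (n + 1) → ep z n = ep w n
  node_S : ∀ z w n, al z = al w → ep z n ≠ ep w n → n ∈ S (al z)
  S_fin : ∀ i j, i ≠ j → (S i ∩ S j).Finite
  node_fin : ∀ j n, {x | ∃ z, al z = j ∧ node z n = x}.Finite
  g_surj : Function.Surjective g
  y_eq : ∀ z n, y z n = cs (Finsupp.single (node z n) 1) +
    p ^ (n + 1) • ((if ep z n then cs (g (al z)) else 0) + p ^ (n + 1) • y z (n + 1))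
  tf : ∀ q : Q, p • q = 0 → q = 0
  tfA : ∀ a : A, p • a = 0 → a = 0
  cs_div : ∀ (q : Q) b, p • q = cs b → ∃ b', b = p • b'
  haus : ∀ q : Q, (∀ N : ℕ, ∃ q', q = p ^ N • q') → q = 0
  hausA : ∀ a : A, (∀ N : ℕ, ∃ a', a = p ^ N • a') → a = 0

namespace GSData

variable {R A J X Z Q : Type} [CommRing R] [Ring A] [Algebra R A]
    [AddCommGroup Q] [Module R Q] [Module A Q] [IsScalarTower R A Q]
    (D : GSData R A J X Z Q)

theorem tfN (n : ℕ) (q : Q) (h : D.p ^ n • q = 0) : q = 0 := by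
  induction n with
  | zero => simpa using h
  | succ n ih => rw [pow_succ', mul_smul] at h; exact ih (D.tf _ h)

theorem tfAN (n : ℕ) (q : A) (h : D.p ^ n • q = 0) : q = 0 := by
  induction n with
  | zero => simpa using h
  | succ n ih => rw [pow_succ', mul_smul] at h; exact ih (D.tfA _ h)

theorem tfN' (n : ℕ) (q q' : Q) (h : D.p ^ n • q = D.p ^ n • q') : q = q' := by
  rw [← sub_eq_zero, ← smul_sub] at h
  exact sub_eq_zero.mp (D.tfN n _ h)

theorem tfAN' (n : ℕ) (q q' : A) (h : D.p ^ n • q = D.p ^ n • q') : q = q' := by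
  rw [← sub_eq_zero, ← smul_sub] at h
  exact sub_eq_zero.mp (D.tfAN n _ h)

theorem cs_smul (r : R) (b : X →₀ A) : D.cs (r • b) = r • D.cs b :=
  LinearMap.map_smul_of_tower D.cs r b

theorem smul_comm' (r : R) (a : A) (q : Q) : a • r • q = r • a • q := by
  rw [← algebraMap_smul A r q, ← algebraMap_smul A r (a • q), ← mul_smul, ← mul_smul,
    Algebra.commutes]

theorem cs_divN (n : ℕ) (q : Q) (b : X →₀ A) (h : D.p ^ n • q = D.cs b) :
    ∃ b', b = D.p ^ n • b' := by
  induction n generalizing b with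
  | zero => exact ⟨b, by simp⟩
  | succ n ih =>
    rw [pow_succ', mul_smul] at h
    obtain ⟨b', rfl⟩ := D.cs_div _ _ h
    rw [cs_smul, ← sub_eq_zero, ← smul_sub] at h
    obtain ⟨b'', rfl⟩ := ih b' (sub_eq_zero.mp (D.tf _ h))
    exact ⟨b'', by rw [pow_succ', mul_smul]⟩

theorem cs_inj (b : X →₀ A) (h : D.cs b = 0) : b = 0 := by
  ext x
  refine D.hausA _ fun N => ?_
  obtain ⟨b', hb⟩ := D.cs_divN N 0 b (by simp [h])
  exact ⟨b' x, by rw [hb]; simp⟩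

theorem cs_inj' {b c : X →₀ A} (h : D.cs b = D.cs c) : b = c :=
  sub_eq_zero.mp (D.cs_inj _ (by rw [map_sub, h, sub_self]))

/-- partial sums -/
noncomputable def part (z : Z) (n : ℕ) : X →₀ A :=
  ∑ i ∈ Finset.range n, (D.p ^ (i * (i + 1)) • Finsupp.single (D.node z i) (1 : A) +
    D.p ^ (i * (i + 1) + (i + 1)) • (if D.ep z i then D.g (D.al z) else 0))

theorem y_part (z : Z) (n : ℕ) : D.y z 0 = D.cs (D.part z n) + D.p ^ (n * (n + 1)) • D.y z n := by
  induction n with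
  | zero => simp [part]
  | succ n ih =>
    have hs : D.part z (n + 1) = D.part z n +
        (D.p ^ (n * (n + 1)) • Finsupp.single (D.node z n) (1 : A) +
        D.p ^ (n * (n + 1) + (n + 1)) • (if D.ep z n then D.g (D.al z) else 0)) := by
      rw [part, Finset.sum_range_succ]; rfl
    have e : (n + 1) * (n + 1 + 1) = n * (n + 1) + (n + 1) + (n + 1) := by ring
    rw [ih, D.y_eq z n, hs, map_add, map_add, cs_smul, cs_smul,
      apply_ite D.cs, map_zero, e, pow_add _ (n * (n + 1) + (n + 1)), pow_add _ (n * (n + 1))]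
    generalize D.p ^ (n * (n + 1)) = u
    generalize D.p ^ (n + 1) = v
    generalize D.cs (D.part z n) = t
    simp only [smul_add, mul_smul, add_assoc]

theorem part_apply [DecidableEq X] (z : Z) (n : ℕ) (x : X) (hx : D.len x = n)
    (hg : D.g (D.al z) x = 0) :
    D.part z (n + 1) x = if D.node z n = x then D.p ^ (n * (n + 1)) • (1 : A) else 0 := by
  rw [part, Finsupp.finsetSum_apply, Finset.sum_eq_single n]
  · split_ifs <;> simp_all
  · intro i _ hin
    have : D.node z i ≠ x := by
      intro h
      apply hin
      rw [← hx, ← h, D.len_node]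
    split_ifs <;> simp_all
  · simp

theorem coord [DecidableEq X] {ι : Type} [Fintype ι] (c : ι → A) (w : ι → Z) (b : X →₀ A)
    (N n : ℕ) (x : X) (q : Q)
    (h : D.cs b + ∑ i, c i • D.y (w i) 0 = D.p ^ N • q) (hN : N ≤ (n + 1) * (n + 2))
    (hx : D.len x = n) (hb : b x = 0) (hg : ∀ i, D.g (D.al (w i)) x = 0) :
    ∃ a : A, ∑ i, (if D.node (w i) n = x then D.p ^ (n * (n + 1)) • c i else 0) = D.p ^ N • a := by
  obtain ⟨k, hk⟩ := Nat.exists_eq_add_of_le hN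
  have h1 : D.p ^ N • (q - ∑ i, c i • D.p ^ k • D.y (w i) (n + 1)) =
      D.cs (b + ∑ i, c i • D.part (w i) (n + 1)) := by
    rw [smul_sub, ← h, map_add, map_sum, Finset.smul_sum, add_sub_assoc, ← Finset.sum_sub_distrib]
    congr 1
    refine Finset.sum_congr rfl fun i _ => ?_
    rw [D.y_part (w i) (n + 1), smul_add, map_smul, show n + 1 + 1 = n + 2 from rfl, hk, pow_add,
      mul_smul, smul_comm' (D.p ^ N)]
    abel
  obtain ⟨b', hb'⟩ := D.cs_divN _ _ _ h1
  refine ⟨b' x, ?_⟩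
  have h2 := DFunLike.congr_fun hb' x
  rw [Finsupp.add_apply, hb, zero_add, Finsupp.finsetSum_apply, Finsupp.smul_apply] at h2
  rw [← h2]
  refine Finset.sum_congr rfl fun i _ => ?_
  rw [Finsupp.smul_apply, D.part_apply (w i) n x hx (hg i)]
  split_ifs
  · rw [smul_eq_mul, mul_smul_comm, mul_one]
  · simp

/-- The span of `B` and the branch elements with index in `T`, -/
noncomputable def H (T : Set Z) : Submodule A Q :=
  LinearMap.range D.cs ⊔ Submodule.span A ((fun z => D.y z 0) '' T)

/-- and its `p`-pure closure. -/
noncomputable def G (T : Set Z) : Submodule A Q where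
  carrier := {q | ∃ n : ℕ, D.p ^ n • q ∈ D.H T}
  add_mem' := by
    rintro a b ⟨n, hn⟩ ⟨m, hm⟩
    refine ⟨n + m, ?_⟩
    rw [smul_add]
    refine Submodule.add_mem _ ?_ ?_
    · rw [add_comm, pow_add, mul_smul, ← algebraMap_smul A]
      exact Submodule.smul_mem _ _ hn
    · rw [pow_add, mul_smul, ← algebraMap_smul A]
      exact Submodule.smul_mem _ _ hm
  zero_mem' := ⟨0, by simp⟩
  smul_mem' := by
    rintro c x ⟨n, hn⟩
    exact ⟨n, by rw [← smul_comm']; exact Submodule.smul_mem _ _ hn⟩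

theorem G_pure (T : Set Z) (n : ℕ) (q : Q) (h : D.p ^ n • q ∈ D.G T) : q ∈ D.G T := by
  obtain ⟨m, hm⟩ := h
  exact ⟨m + n, by rwa [pow_add, mul_smul]⟩

theorem smul_memG (T : Set Z) (r : R) (q : Q) (h : q ∈ D.G T) : r • q ∈ D.G T := by
  rw [← algebraMap_smul A]
  exact Submodule.smul_mem _ _ h

theorem H_le_G (T : Set Z) : D.H T ≤ D.G T := fun q h => ⟨0, by simpa using h⟩

theorem cs_mem (T : Set Z) (b : X →₀ A) : D.cs b ∈ D.G T :=
  D.H_le_G T (Submodule.mem_sup_left ⟨b, rfl⟩)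

theorem y_mem (T : Set Z) (z : Z) (hz : z ∈ T) (n : ℕ) : D.y z n ∈ D.G T := by
  apply D.G_pure T (n * (n + 1))
  have : D.p ^ (n * (n + 1)) • D.y z n = D.y z 0 - D.cs (D.part z n) := by
    rw [D.y_part z n]; abel
  rw [this]
  exact Submodule.sub_mem _
    (D.H_le_G T (Submodule.mem_sup_right (Submodule.subset_span ⟨z, hz, rfl⟩))) (D.cs_mem T _)

theorem mem_rep (T : Set Z) (q : Q) (h : q ∈ D.G T) : ∃ (m : ℕ) (b : X →₀ A) (C : Z →₀ A),
    D.p ^ m • q = D.cs b + C.sum (fun z a => a • D.y z 0) := by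
  obtain ⟨m, hm⟩ := h
  obtain ⟨_, ⟨b, rfl⟩, v, hv, e⟩ := Submodule.mem_sup.mp hm
  obtain ⟨C, -, hC⟩ := (Finsupp.mem_span_image_iff_linearCombination A).mp hv
  exact ⟨m, b, C, by rw [← e, ← hC, Finsupp.linearCombination_apply]⟩

theorem rep_mem (q : Q) (m : ℕ) (b : X →₀ A) (C : Z →₀ A)
    (h : D.p ^ m • q = D.cs b + C.sum (fun z a => a • D.y z 0)) : q ∈ D.G C.support := by
  apply D.G_pure _ m
  rw [h]
  refine Submodule.add_mem _ (D.cs_mem _ _) (Submodule.sum_mem _ fun z hz => ?_)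
  exact Submodule.smul_mem _ _ (D.y_mem _ z hz 0)

theorem G_mono {T T' : Set Z} (h : T ⊆ T') : D.G T ≤ D.G T' := by
  rintro q ⟨n, hn⟩
  refine ⟨n, ?_⟩
  exact (sup_le_sup le_rfl (Submodule.span_mono (Set.image_mono h)) : D.H T ≤ D.H T') hn


theorem G_free (T : Set Z) (hT : T.Countable) : Module.Free A (D.G T) := by
  classical
  obtain ⟨enc, henc⟩ := Set.countable_iff_exists_injOn.mp hT
  have hsep : ∀ z w, ∃ N, z ≠ w → ∀ n, N ≤ n → D.node z n ≠ D.node w n := by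
    intro z w
    by_cases h : z = w
    · exact ⟨0, fun h' => absurd h h'⟩
    · obtain ⟨N, hN⟩ := D.node_sep z w h
      exact ⟨N, fun _ n hn h' => hN (D.node_mono z w N n hn h')⟩
  choose Br hBr using hsep
  have hnz : ∀ z, ∃ N, (∀ w ∈ T, enc w < enc z → Br z w ≤ N) ∧
      ∀ x ∈ (D.g (D.al z)).support, D.len x < N := by
    intro z
    have hfin : {w | w ∈ T ∧ enc w < enc z}.Finite := by
      apply Set.Finite.of_finite_image (f := enc)
      · exact (Set.finite_Iio (enc z)).subset (by rintro _ ⟨w, hw, rfl⟩; exact hw.2)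
      · exact henc.mono fun w hw => hw.1
    obtain ⟨N1, h1⟩ := (hfin.image (Br z)).bddAbove
    obtain ⟨N2, h2⟩ := ((D.g (D.al z)).support.image D.len).finite_toSet.bddAbove
    refine ⟨N1 + N2 + 1, fun w hw hlt => ?_, fun x hx => ?_⟩
    · have := h1 ⟨w, ⟨hw, hlt⟩, rfl⟩
      omega
    · have := h2 (by simpa using ⟨x, by simpa using hx, rfl⟩ : D.len x ∈ _)
      omega
  choose nz hnz1 hnz2 using hnz
  have huniq : ∀ z ∈ T, ∀ w ∈ T, ∀ i, nz z ≤ i → nz w ≤ i → D.node z i = D.node w i → z = w := by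
    intro z hz w hw i h1 h2 h
    by_contra hne
    rcases lt_trichotomy (enc z) (enc w) with hl | hl | hl
    · exact hBr w z (Ne.symm hne) i ((hnz1 w z hz hl).trans h2) h.symm
    · exact hne (henc hz hw hl)
    · exact hBr z w hne i ((hnz1 z w hw hl).trans h1) h
  let P : X → Z → Prop := fun x z => z ∈ T ∧ nz z ≤ D.len x ∧ D.node z (D.len x) = x
  let bb : X → Q := fun x => if h : ∃ z, P x z then D.y h.choose (D.len x)
    else D.cs (Finsupp.single x 1)
  have bb_node : ∀ z ∈ T, ∀ i, nz z ≤ i → bb (D.node z i) = D.y z i := by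
    intro z hz i hi
    have h : ∃ w, P (D.node z i) w := ⟨z, hz, by rw [D.len_node]; exact hi, by rw [D.len_node]⟩
    have hs := h.choose_spec
    have e : h.choose = z := by
      obtain ⟨h1, h2, h3⟩ := hs
      rw [D.len_node] at h2 h3
      exact huniq _ h1 z hz i h2 hi h3
    simp only [bb, dif_pos h]
    rw [e, D.len_node]
  have bb_other : ∀ x, (¬ ∃ z, P x z) → bb x = D.cs (Finsupp.single x 1) := by
    intro x h
    simp only [bb, dif_neg h]
  have bb_mod : ∀ x, ∃ q, bb x = D.cs (Finsupp.single x 1) + D.p • q := by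
    intro x
    by_cases h : ∃ z, P x z
    · obtain ⟨z, hz, h1, h2⟩ := h
      refine ⟨D.p ^ (D.len x) • ((if D.ep z (D.len x) then D.cs (D.g (D.al z)) else 0) +
        D.p ^ (D.len x + 1) • D.y z (D.len x + 1)), ?_⟩
      conv_lhs => rw [← h2]
      rw [bb_node z hz _ h1, D.y_eq, h2, ← mul_smul D.p, ← pow_succ']
    · exact ⟨0, by rw [bb_other x h]; simp⟩
  choose qq hqq using bb_mod
  have lc : ∀ l : X →₀ A, Finsupp.linearCombination A bb l =
      D.cs l + D.p • l.sum (fun x a => a • qq x) := by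
    intro l
    have hcs : D.cs l = ∑ x ∈ l.support, D.cs (Finsupp.single x (l x)) := by
      conv_lhs => rw [← Finsupp.sum_single l, Finsupp.sum, map_sum]
    rw [Finsupp.linearCombination_apply, Finsupp.sum, Finsupp.sum, Finset.smul_sum, hcs]
    rw [← Finset.sum_add_distrib]
    refine Finset.sum_congr rfl fun x _ => ?_
    rw [hqq x, smul_add, smul_comm' D.p, ← map_smul, Finsupp.smul_single, smul_eq_mul, mul_one]
  have lc_smul : ∀ l : X →₀ A, Finsupp.linearCombination A bb (D.p • l) =
      D.p • Finsupp.linearCombination A bb l :=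
    fun l => LinearMap.map_smul_of_tower _ _ _
  have lc_div : ∀ (q : Q) (l : X →₀ A), D.p • q = Finsupp.linearCombination A bb l →
      ∃ l', l = D.p • l' ∧ q = Finsupp.linearCombination A bb l' := by
    intro q l h
    obtain ⟨l', rfl⟩ := D.cs_div (q - l.sum (fun x a => a • qq x)) l (by
      rw [smul_sub, h, lc]; abel)
    refine ⟨l', rfl, ?_⟩
    rw [lc_smul, ← sub_eq_zero, ← smul_sub] at h
    exact sub_eq_zero.mp (D.tf _ h)
  have hli : LinearIndependent A bb := by
    rw [linearIndependent_iff]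
    intro l hl
    have key : ∀ N : ℕ, ∃ l', l = D.p ^ N • l' ∧ Finsupp.linearCombination A bb l' = 0 := by
      intro N
      induction N with
      | zero => exact ⟨l, by simp, hl⟩
      | succ N ih =>
        obtain ⟨l', h1, h2⟩ := ih
        obtain ⟨l'', h3, h4⟩ := lc_div 0 l' (by rw [h2, smul_zero])
        exact ⟨l'', by rw [h1, h3, pow_succ, mul_smul], h4.symm⟩
    ext x
    refine D.hausA _ fun N => ?_
    obtain ⟨l', h, -⟩ := key N
    exact ⟨l' x, by rw [h]; simp⟩
  set F := Submodule.span A (Set.range bb) with hF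
  have memF : ∀ q, q ∈ F ↔ ∃ l, Finsupp.linearCombination A bb l = q := by
    intro q
    rw [hF, ← Finsupp.range_linearCombination]
    rfl
  have F_pure : ∀ (n : ℕ) q, D.p ^ n • q ∈ F → q ∈ F := by
    intro n
    induction n with
    | zero => intro q h; simpa using h
    | succ n ih =>
      intro q h
      rw [pow_succ', mul_smul] at h
      apply ih
      obtain ⟨l, hl⟩ := (memF _).mp h
      obtain ⟨l', -, h2⟩ := lc_div _ _ hl.symm
      exact (memF _).mpr ⟨l', h2.symm⟩
  have F_smul : ∀ (r : R) q, q ∈ F → r • q ∈ F := by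
    intro r q h
    rw [← algebraMap_smul A]
    exact Submodule.smul_mem _ _ h
  have F_of_single : ∀ b : X →₀ A, (∀ x ∈ b.support, D.cs (Finsupp.single x 1) ∈ F) →
      D.cs b ∈ F := by
    intro b h
    rw [← Finsupp.sum_single b, Finsupp.sum, map_sum]
    refine Submodule.sum_mem _ fun x hx => ?_
    have : Finsupp.single x (b x) = b x • Finsupp.single x (1 : A) := by simp
    rw [this, map_smul]
    exact Submodule.smul_mem _ _ (h x hx)
  have F_single : ∀ n : ℕ, ∀ x, D.len x = n → D.cs (Finsupp.single x 1) ∈ F := by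
    intro n
    induction n using Nat.strong_induction_on with
    | _ n ih =>
    intro x hx
    by_cases h : ∃ z, P x z
    · obtain ⟨z, hz, h1, h2⟩ := h
      rw [hx] at h1 h2
      have e := D.y_eq z n
      rw [h2] at e
      have e2 : D.cs (Finsupp.single x 1) = D.y z n - D.p ^ (n + 1) •
          ((if D.ep z n then D.cs (D.g (D.al z)) else 0) + D.p ^ (n + 1) • D.y z (n + 1)) := by
        rw [e]; abel
      rw [e2]
      refine Submodule.sub_mem _ ?_ (F_smul _ _ (Submodule.add_mem _ ?_ (F_smul _ _ ?_)))
      · rw [← bb_node z hz n h1]; exact Submodule.subset_span ⟨_, rfl⟩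
      · split_ifs
        · exact F_of_single _ fun x' hx' => ih _ ((hnz2 z x' hx').trans_le h1) x' rfl
        · exact Submodule.zero_mem _
      · rw [← bb_node z hz (n + 1) (by omega)]; exact Submodule.subset_span ⟨_, rfl⟩
    · rw [← bb_other x h]; exact Submodule.subset_span ⟨_, rfl⟩
  have F_cs : ∀ b, D.cs b ∈ F := fun b => F_of_single b fun x _ => F_single _ x rfl
  have hHF : D.H T ≤ F := by
    refine sup_le ?_ (Submodule.span_le.mpr ?_)
    · rintro _ ⟨b, rfl⟩; exact F_cs b
    · rintro _ ⟨z, hz, rfl⟩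
      change D.y z 0 ∈ F
      rw [D.y_part z (nz z)]
      refine Submodule.add_mem _ (F_cs _) (F_smul _ _ ?_)
      rw [← bb_node z hz _ le_rfl]; exact Submodule.subset_span ⟨_, rfl⟩
  have hGF : D.G T = F := by
    apply le_antisymm
    · rintro q ⟨n, hn⟩
      exact F_pure n q (hHF hn)
    · refine Submodule.span_le.mpr ?_
      rintro _ ⟨x, rfl⟩
      by_cases h : ∃ z, P x z
      · obtain ⟨z, hz, h1, h2⟩ := h
        rw [← h2, bb_node z hz _ h1]
        exact D.y_mem T z hz _
      · rw [bb_other x h]; exact D.cs_mem T _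
  rw [hGF]
  exact Module.Free.of_basis (Module.Basis.span hli)

theorem GS_free_of_le [IsDomain R] [IsPrincipalIdealRing R] {M : Type} [AddCommGroup M]
    [Module R M] (P : Submodule A Q) (hP : Module.Free R P) (f : M →ₗ[R] Q)
    (hf : Function.Injective f) (h : ∀ x, f x ∈ P) : Module.Free R M := by
  let f' : M →ₗ[R] P :=
    { toFun := fun x => ⟨f x, h x⟩
      map_add' := fun x y => Subtype.ext (map_add f x y)
      map_smul' := fun r x => Subtype.ext (map_smul f r x) }
  exact GS_free_inj f' fun x y hxy => hf (congrArg (fun t : P => t.1) hxy)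

/-- `ℵ₁`-freeness. -/
theorem aleph1_free [IsDomain R] [IsPrincipalIdealRing R] [Module.Free R A]
    (N : Submodule R (D.G Set.univ)) (s : Set (D.G Set.univ)) (hs : s.Countable)
    (hN : N = Submodule.span R s) : Module.Free R N := by
  have hr : ∀ x : D.G Set.univ, ∃ T : Set Z, T.Countable ∧ x.1 ∈ D.G T := by
    intro x
    obtain ⟨m, b, C, h⟩ := D.mem_rep _ _ x.2
    exact ⟨C.support, C.support.countable_toSet, D.rep_mem _ m b C h⟩
  choose T hT hxT using hr
  let U : Set Z := ⋃ x ∈ s, T x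
  have hU : U.Countable := hs.biUnion fun x _ => hT x
  have hfree : Module.Free A (D.G U) := D.G_free U hU
  have : Module.Free R (D.G U) := Module.Free.trans (S := A)
  have hle : ∀ x ∈ N, x.1 ∈ D.G U := by
    intro x hx
    rw [hN] at hx
    induction hx using Submodule.span_induction with
    | mem x hx => exact D.G_mono (Set.subset_biUnion_of_mem (u := T) hx) (hxT x)
    | zero => exact Submodule.zero_mem _
    | add x y _ _ h1 h2 => exact Submodule.add_mem _ h1 h2
    | smul r x _ h => exact D.smul_memG U r _ h
  exact GS_free_of_le (D.G U) this (((D.G Set.univ).subtype.restrictScalars R) ∘ₗ N.subtype)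
    (Subtype.val_injective.comp Subtype.val_injective) (fun x => hle x.1 x.2)

theorem diff (z w : Z) (n : ℕ) (h : D.node z n = D.node w n) :
    D.y z 0 - D.y w 0 = D.p ^ (n * (n + 1) + (n + 1)) •
      (((if D.ep z n then D.cs (D.g (D.al z)) else 0) -
        (if D.ep w n then D.cs (D.g (D.al w)) else 0)) +
        D.p ^ (n + 1) • (D.y z (n + 1) - D.y w (n + 1))) := by
  have hp : D.part z n = D.part w n := by
    rw [part, part]
    refine Finset.sum_congr rfl fun i hi => ?_
    have hi' : i < n := Finset.mem_range.mp hi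
    rw [D.node_mono z w i n hi'.le h, D.node_al z w n h,
      D.node_ep z w i (D.node_mono z w (i + 1) n hi' h)]
  rw [D.y_part z n, D.y_part w n, hp, D.y_eq z n, D.y_eq w n, h,
    pow_add _ (n * (n + 1)) (n + 1), mul_smul]
  generalize D.p ^ (n * (n + 1)) = u
  generalize D.p ^ (n + 1) = v
  simp only [smul_add, smul_sub]
  abel

theorem rep' (q : Q) (h : q ∈ D.G Set.univ) :
    ∃ (m n0 : ℕ) (b : X →₀ A) (K : ℕ) (c : Fin K → A) (w : Fin K → Z),
      (∀ i, c i ≠ 0) ∧ (∀ i j, i ≠ j → D.node (w i) n0 ≠ D.node (w j) n0) ∧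
      (∀ x, n0 ≤ D.len x → b x = 0 ∧ ∀ i, D.g (D.al (w i)) x = 0) ∧
      D.p ^ m • q = D.cs b + ∑ i, c i • D.y (w i) 0 := by
  classical
  obtain ⟨m, b, C, hC⟩ := D.mem_rep _ _ h
  let e := C.support.equivFin
  let K := C.support.card
  let w : Fin K → Z := fun i => (e.symm i).1
  have hw : Function.Injective w := Subtype.val_injective.comp e.symm.injective
  have h1 : ∀ ij : Fin K × Fin K, ∃ n, ij.1 ≠ ij.2 → D.node (w ij.1) n ≠ D.node (w ij.2) n := by
    intro ij
    by_cases hij : ij.1 = ij.2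
    · exact ⟨0, fun h => absurd hij h⟩
    · obtain ⟨n, hn⟩ := D.node_sep _ _ (hw.ne hij)
      exact ⟨n, fun _ => hn⟩
  choose N1 hN1 using h1
  have h2 : ∀ f : X →₀ A, ∃ n, ∀ x, n ≤ D.len x → f x = 0 := by
    intro f
    obtain ⟨N2, h2⟩ := (f.support.image D.len).finite_toSet.bddAbove
    refine ⟨N2 + 1, fun x hx => ?_⟩
    by_contra hne
    have := h2 (by simpa using ⟨x, by simpa using hne, rfl⟩ : D.len x ∈ _)
    omega
  choose N2 hN2 using h2
  let n0 := (∑ ij, N1 ij) + (N2 b + ∑ i, N2 (D.g (D.al (w i))))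
  refine ⟨m, n0, b, K, fun i => C (w i), w, ?_, ?_, ?_, ?_⟩
  · intro i
    exact Finsupp.mem_support_iff.mp (e.symm i).2
  · intro i j hij hn
    have hle : N1 (i, j) ≤ n0 := by
      have := Finset.single_le_sum (f := N1) (fun _ _ => Nat.zero_le _) (Finset.mem_univ (i, j))
      simp only [n0]; omega
    exact hN1 (i, j) hij (D.node_mono _ _ _ _ hle hn)
  · intro x hx
    refine ⟨hN2 b x (by simp only [n0] at hx; omega), fun i => hN2 _ x ?_⟩
    have := Finset.single_le_sum (f := fun i => N2 (D.g (D.al (w i))))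
      (fun _ _ => Nat.zero_le _) (Finset.mem_univ i)
    simp only [n0] at hx
    omega
  · rw [hC, Finsupp.sum, ← Finset.sum_coe_sort, ← Equiv.sum_comp e.symm]

/-- The type of invariants used in the pigeonhole argument. -/
abbrev Dat (A X : Type) [Zero A] : Type := ℕ × ℕ × (X →₀ A) × (Σ K : ℕ, (Fin K → A × X))

theorem dvd_coeff {ι : Type} [Fintype ι] (c : ι → A) (w : ι → Z) (b : X →₀ A)
    (n : ℕ) (k : ι) (q : Q)
    (h : D.cs b + ∑ i, c i • D.y (w i) 0 = D.p ^ (n * (n + 1) + (n + 1)) • q)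
    (hb : b (D.node (w k) n) = 0) (hg : ∀ i, D.g (D.al (w i)) (D.node (w k) n) = 0)
    (hd : ∀ i, i ≠ k → D.node (w i) n ≠ D.node (w k) n) :
    ∃ a : A, c k = D.p ^ (n + 1) • a := by
  classical
  obtain ⟨a, ha⟩ := D.coord c w b (n * (n + 1) + (n + 1)) n (D.node (w k) n) q h (by nlinarith)
    (D.len_node _ _) hb hg
  rw [Finset.sum_eq_single k (fun i _ hi => if_neg (hd i hi)) (by simp), if_pos rfl, pow_add,
    mul_smul] at ha
  exact ⟨a, D.tfAN' _ _ _ ha⟩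

theorem close_lemma (hpig : ∀ j, ∀ f : {z // D.al z = j} → Dat A X, ∃ d, Infinite (f ⁻¹' {d}))
    (φ : D.G Set.univ →ₗ[R] Q) (hφ : ∀ x, φ x ∈ D.G Set.univ) (j : J) :
    ∃ m : ℕ, ∀ N : ℕ, ∃ (a : A) (q : Q),
      D.p ^ m • φ ⟨D.cs (D.g j), D.cs_mem _ _⟩ = a • D.cs (D.g j) + D.p ^ N • q := by
  classical
  have hrep : ∀ z : {z // D.al z = j}, ∃ d : Dat A X, ∃ w : Fin d.2.2.2.1 → Z,
      (∀ i, (d.2.2.2.2 i).1 ≠ 0) ∧ (∀ i, D.node (w i) d.2.1 = (d.2.2.2.2 i).2) ∧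
      (∀ i i', i ≠ i' → D.node (w i) d.2.1 ≠ D.node (w i') d.2.1) ∧
      (∀ x, d.2.1 ≤ D.len x → ∀ i, D.g (D.al (w i)) x = 0) ∧
      D.p ^ d.1 • φ ⟨D.y z 0, D.y_mem _ _ (Set.mem_univ _) 0⟩ =
        D.cs d.2.2.1 + ∑ i, (d.2.2.2.2 i).1 • D.y (w i) 0 := by
    intro z
    obtain ⟨m, n0, b, K, c, w, h1, h2, h3, h4⟩ := D.rep' _ (hφ ⟨D.y z 0, D.y_mem _ _ (Set.mem_univ _) 0⟩)
    exact ⟨(m, n0, b, ⟨K, fun i => (c i, D.node (w i) n0)⟩), w, h1, fun i => rfl, h2,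
      fun x hx => (h3 x hx).2, h4⟩
  choose f hf using hrep
  obtain ⟨⟨m, n0, b, K, cx⟩, hd⟩ := hpig j f
  obtain ⟨T, hT⟩ : ∃ T : Set {z // D.al z = j}, T = f ⁻¹' {(m, n0, b, ⟨K, cx⟩)} := ⟨_, rfl⟩
  rw [← hT] at hd
  have hF : ∀ z : T, ∃ w : Fin K → Z,
      (∀ i, (cx i).1 ≠ 0) ∧ (∀ i, D.node (w i) n0 = (cx i).2) ∧
      (∀ i i', i ≠ i' → D.node (w i) n0 ≠ D.node (w i') n0) ∧
      (∀ x, n0 ≤ D.len x → ∀ i, D.g (D.al (w i)) x = 0) ∧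
      D.p ^ m • φ ⟨D.y z.1.1 0, D.y_mem _ _ (Set.mem_univ _) 0⟩ =
        D.cs b + ∑ i, (cx i).1 • D.y (w i) 0 := by
    rintro ⟨z, hz⟩
    have hz' : f z = (m, n0, b, ⟨K, cx⟩) := by rw [hT] at hz; exact hz
    have := hf z
    rw [hz'] at this
    exact this
  choose W hc hn0 hinj hgz hW using hF
  obtain ⟨z1⟩ := hd.nonempty
  have hc := hc z1
  refine ⟨m, fun N => ?_⟩
  -- bounds
  have hN0 : ∀ k, ∃ N0 : ℕ, ¬ ∃ a', (cx k).1 = D.p ^ N0 • a' := by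
    intro k
    by_contra hcon
    push Not at hcon
    exact hc k (D.hausA _ hcon)
  choose N0 hN0 using hN0
  have hS : ∀ k, ∃ N1 : ℕ, D.al (W z1 k) ≠ j → ∀ n ∈ D.S (D.al (W z1 k)) ∩ D.S j, n < N1 := by
    intro k
    by_cases hk : D.al (W z1 k) = j
    · exact ⟨0, fun h => absurd hk h⟩
    · obtain ⟨N1, h1⟩ := (D.S_fin _ _ hk).bddAbove
      exact ⟨N1 + 1, fun _ n hn => Nat.lt_succ_of_le (h1 hn)⟩
  choose N1 hN1 using hS
  let M := N + n0 + (∑ k, N0 k + ∑ k, N1 k)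
  have hM0 : ∀ k, N0 k ≤ M := fun k => by
    have := Finset.single_le_sum (f := N0) (fun _ _ => Nat.zero_le _) (Finset.mem_univ k)
    simp only [M]; omega
  have hM1 : ∀ k, N1 k ≤ M := fun k => by
    have := Finset.single_le_sum (f := N1) (fun _ _ => Nat.zero_le _) (Finset.mem_univ k)
    simp only [M]; omega
  -- two branches
  obtain ⟨z, z', hne, hM⟩ : ∃ z z' : T, z ≠ z' ∧
      D.node z.1.1 M = D.node z'.1.1 M := by
    have : Finite {x | ∃ z, D.al z = j ∧ D.node z M = x} := D.node_fin j M
    obtain ⟨z, z', h1, h2⟩ := Finite.exists_ne_map_eq_of_infinite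
      (fun z : T =>
        (⟨D.node z.1.1 M, z.1.1, z.1.2, rfl⟩ : {x | ∃ z, D.al z = j ∧ D.node z M = x}))
    exact ⟨z, z', h1, congrArg Subtype.val h2⟩
  have hne' : z.1.1 ≠ z'.1.1 := fun h => hne (Subtype.ext (Subtype.ext h))
  obtain ⟨n, hnM, hn, hn1⟩ : ∃ n, M ≤ n ∧ D.node z.1.1 n = D.node z'.1.1 n ∧
      D.node z.1.1 (n + 1) ≠ D.node z'.1.1 (n + 1) := by
    have hex := D.node_sep _ _ hne'
    have hs := Nat.find_spec hex
    have hlt : M < Nat.find hex := by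
      by_contra hle
      exact hs (D.node_mono _ _ _ _ (not_lt.mp hle) hM)
    refine ⟨Nat.find hex - 1, by omega, ?_, ?_⟩
    · by_contra h
      have := Nat.find_min' hex h
      omega
    · rwa [Nat.sub_add_cancel (by omega)]
  have hep : D.ep z.1.1 n ≠ D.ep z'.1.1 n := fun h => hn1 (D.node_succ _ _ _ hn h)
  have halz : D.al z.1.1 = j := z.1.2
  have halz' : D.al z'.1.1 = j := z'.1.2
  have hnS : n ∈ D.S j := by
    have := D.node_S z.1.1 z'.1.1 n (by rw [halz, halz']) hep
    rwa [halz] at this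
  obtain ⟨σ, hσ, hσ2⟩ : ∃ σ : R, σ * σ = 1 ∧
      (if D.ep z.1.1 n then D.cs (D.g (D.al z.1.1)) else 0) -
      (if D.ep z'.1.1 n then D.cs (D.g (D.al z'.1.1)) else 0) = σ • D.cs (D.g j) := by
    rw [halz, halz']
    cases h1 : D.ep z.1.1 n <;> cases h2 : D.ep z'.1.1 n
    · exact absurd (h1.trans h2.symm) hep
    · exact ⟨-1, by ring, by simp⟩
    · exact ⟨1, by ring, by simp⟩
    · exact absurd (h1.trans h2.symm) hep
  -- the main equation
  set ξ : D.G Set.univ := ⟨D.y z.1.1 (n + 1), D.y_mem _ _ (Set.mem_univ _) _⟩ -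
    ⟨D.y z'.1.1 (n + 1), D.y_mem _ _ (Set.mem_univ _) _⟩ with hξ
  set E := n * (n + 1) + (n + 1) with hE
  set γ : D.G Set.univ := ⟨D.cs (D.g j), D.cs_mem _ _⟩ with hγ
  have hdz : (⟨D.y z.1.1 0, D.y_mem _ _ (Set.mem_univ _) 0⟩ : D.G Set.univ) -
      ⟨D.y z'.1.1 0, D.y_mem _ _ (Set.mem_univ _) 0⟩ = D.p ^ E • (σ • γ + D.p ^ (n + 1) • ξ) := by
    apply Subtype.ext
    have := D.diff _ _ n hn
    rw [hσ2] at this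
    exact this
  have hmain : ∑ k, (cx k).1 • (D.y (W z k) 0 - D.y (W z' k) 0) =
      D.p ^ E • D.p ^ m • (σ • φ γ + D.p ^ (n + 1) • φ ξ) := by
    have h1 := congrArg φ hdz
    rw [map_sub, map_smul, map_add, map_smul, map_smul] at h1
    rw [smul_comm, ← h1, smul_sub, hW z, hW z', add_sub_add_left_eq_sub, ← Finset.sum_sub_distrib]
    exact Finset.sum_congr rfl fun k _ => smul_sub _ _ _
  have hnode : ∀ k, D.node (W z k) n = D.node (W z' k) n := by
    intro k
    by_contra hk
    have hn0n : n0 ≤ n := by simp only [M] at hnM; omega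
    have hlen : n0 ≤ D.len (D.node (W z k) n) := by rw [D.len_node]; exact hn0n
    obtain ⟨a, ha⟩ := D.dvd_coeff (ι := Fin K ⊕ Fin K)
      (Sum.elim (fun k => (cx k).1) (fun k => -(cx k).1)) (Sum.elim (W z) (W z')) 0 n (Sum.inl k)
      (D.p ^ m • (σ • φ γ + D.p ^ (n + 1) • φ ξ)) (by
        rw [← hE, ← hmain, map_zero, zero_add, Fintype.sum_sum_type, ← Finset.sum_add_distrib]
        refine Finset.sum_congr rfl fun i _ => ?_
        simp [smul_sub, sub_eq_add_neg]) rfl (by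
        rintro (i | i)
        · exact hgz z _ hlen i
        · exact hgz z' _ hlen i) (by
        rintro (i | i) hi heq
        · have hi' : i ≠ k := fun h => hi (by rw [h])
          exact hinj z i k hi' (D.node_mono _ _ _ _ hn0n heq)
        · by_cases hik : i = k
          · subst hik; exact hk heq.symm
          · have := D.node_mono _ _ _ _ hn0n heq
            simp only [Sum.elim_inr, Sum.elim_inl] at this
            rw [hn0 z' i, ← hn0 z i] at this
            exact hinj z i k hik this)
    refine hN0 k ⟨D.p ^ (n + 1 - N0 k) • a, ?_⟩
    rw [← mul_smul, ← pow_add, Nat.add_sub_cancel' (by have := hM0 k; omega)]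
    exact ha
  have hη : ∀ k, ∃ η : R, D.y (W z k) 0 - D.y (W z' k) 0 =
      D.p ^ E • (η • D.cs (D.g j) + D.p ^ (n + 1) • (D.y (W z k) (n + 1) - D.y (W z' k) (n + 1))) := by
    intro k
    have hd := D.diff _ _ n (hnode k)
    have hal := D.node_al _ _ _ (hnode k)
    rw [← hal] at hd
    by_cases he : D.ep (W z k) n = D.ep (W z' k) n
    · refine ⟨0, ?_⟩
      rw [hd, he, sub_self, zero_smul]
    · have hSk := D.node_S _ _ n hal he
      have halk : D.al (W z k) = D.al (W z1 k) :=
        D.node_al _ _ n0 (by rw [hn0 z k, hn0 z1 k])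
      have hj : D.al (W z k) = j := by
        by_contra hcon
        rw [halk] at hSk hcon
        have := hN1 k hcon n ⟨hSk, hnS⟩
        have := hM1 k
        omega
      rw [hd, hj, ← hE]
      cases h1 : D.ep (W z k) n <;> cases h2 : D.ep (W z' k) n
      · exact absurd (h1.trans h2.symm) he
      · exact ⟨-1, by simp⟩
      · exact ⟨1, by simp⟩
      · exact absurd (h1.trans h2.symm) he
  choose η hη using hη
  have hfin : D.p ^ m • (σ • φ γ + D.p ^ (n + 1) • φ ξ) =
      ∑ k, (cx k).1 • (η k • D.cs (D.g j) +
        D.p ^ (n + 1) • (D.y (W z k) (n + 1) - D.y (W z' k) (n + 1))) := by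
    apply D.tfN' E
    rw [← hmain, Finset.smul_sum]
    refine Finset.sum_congr rfl fun k _ => ?_
    rw [hη k, smul_comm']
  have hfin2 : D.p ^ m • φ γ = (σ • ∑ k, η k • (cx k).1) • D.cs (D.g j) +
      D.p ^ (n + 1) • (σ • (∑ k, (cx k).1 • (D.y (W z k) (n + 1) - D.y (W z' k) (n + 1))
        - D.p ^ m • φ ξ)) := by
    have h1 : D.p ^ m • σ • φ γ = ∑ k, (cx k).1 • (η k • D.cs (D.g j) +
        D.p ^ (n + 1) • (D.y (W z k) (n + 1) - D.y (W z' k) (n + 1))) -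
        D.p ^ m • D.p ^ (n + 1) • φ ξ := by
      rw [← hfin, smul_add]; abel
    have h2 : D.p ^ m • φ γ = σ • D.p ^ m • σ • φ γ := by
      rw [smul_comm σ, ← mul_smul σ, hσ, one_smul]
    rw [h2, h1]
    simp only [smul_add, smul_sub, Finset.sum_add_distrib, Finset.sum_sub_distrib, smul_assoc,
      Finset.sum_smul, Finset.smul_sum, smul_comm' (R := R) (A := A)]
    rw [smul_comm (D.p ^ m) (D.p ^ (n + 1)), smul_comm σ (D.p ^ (n + 1))]
    simp only [smul_comm σ (D.p ^ (n + 1))]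
    abel
  refine ⟨(σ • ∑ k, η k • (cx k).1), D.p ^ (n + 1 - N) • (σ • (∑ k, (cx k).1 • (D.y (W z k) (n + 1) - D.y (W z' k) (n + 1))
        - D.p ^ m • φ ξ)), ?_⟩
  rw [← mul_smul (D.p ^ N), ← pow_add, Nat.add_sub_cancel' (by simp only [M] at hnM; omega)]
  exact hfin2

theorem len_bound (f : X →₀ A) : ∃ n, ∀ x, n ≤ D.len x → f x = 0 := by
  classical
  obtain ⟨N2, h2⟩ := (f.support.image D.len).finite_toSet.bddAbove
  refine ⟨N2 + 1, fun x hx => ?_⟩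
  by_contra hne
  have := h2 (by simpa using ⟨x, by simpa using hne, rfl⟩ : D.len x ∈ _)
  omega

theorem span_lemma (u : Q) (hu : u ∈ D.G Set.univ) (g : X →₀ A) (x0 : X) (hg : g x0 = 1)
    (h : ∀ N : ℕ, ∃ (a : A) (q : Q), u = a • D.cs g + D.p ^ N • q) :
    ∃ (m : ℕ) (a : A), D.p ^ m • u = a • D.cs g := by
  classical
  obtain ⟨m, n0, b, K, c, w, h1, h2, h3, h4⟩ := D.rep' u hu
  obtain ⟨n1, hn1⟩ := D.len_bound g
  have hK : ∀ k : Fin K, False := by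
    intro k
    refine h1 k (D.hausA _ fun N => ?_)
    obtain ⟨n, hn⟩ : ∃ n, n = N + n0 + n1 := ⟨_, rfl⟩
    obtain ⟨a, q, hq⟩ := h (n * (n + 1) + (n + 1))
    have hlen := D.len_node (w k) n
    obtain ⟨a', ha'⟩ := D.dvd_coeff c w (b - (D.p ^ m • a) • g) n k (D.p ^ m • q) (by
      have e : D.cs b + ∑ i, c i • D.y (w i) 0 =
          D.p ^ m • (a • D.cs g + D.p ^ (n * (n + 1) + (n + 1)) • q) := by rw [← h4, ← hq]
      rw [map_sub, map_smul, sub_add_eq_add_sub, e, smul_add, smul_assoc,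
        smul_comm (D.p ^ m) (D.p ^ (n * (n + 1) + (n + 1)))]
      abel) (by
      rw [Finsupp.sub_apply, Finsupp.smul_apply, (h3 _ (by omega)).1, hn1 _ (by omega)]; simp)
      (fun i => (h3 _ (by omega)).2 i)
      (fun i hi he => h2 i k hi (D.node_mono _ _ _ _ (by omega) he))
    refine ⟨D.p ^ (n + 1 - N) • a', ?_⟩
    rw [← mul_smul, ← pow_add, Nat.add_sub_cancel' (by omega)]
    exact ha'
  have hb : D.p ^ m • u = D.cs b := by
    rw [h4, Finset.sum_eq_zero (fun i _ => (hK i).elim), add_zero]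
  refine ⟨m, b x0, ?_⟩
  rw [hb, ← map_smul]
  congr 1
  ext x
  rw [← sub_eq_zero]
  refine D.hausA _ fun N => ?_
  obtain ⟨a, q, hq⟩ := h N
  obtain ⟨b', hb'⟩ := D.cs_divN N (D.p ^ m • q) (b - (D.p ^ m • a) • g) (by
    rw [map_sub, map_smul, ← hb, hq, smul_add, smul_assoc, smul_comm (D.p ^ m) (D.p ^ N)]
    abel)
  have e1 := DFunLike.congr_fun hb' x
  have e2 := DFunLike.congr_fun hb' x0
  simp only [Finsupp.sub_apply, Finsupp.smul_apply, smul_eq_mul, hg, mul_one] at e1 e2 ⊢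
  refine ⟨b' x - b' x0 * g x, ?_⟩
  rw [smul_sub, ← e1, ← smul_mul_assoc, ← e2, sub_mul]
  abel

theorem eig_lemma (hpig : ∀ j, ∀ f : {z // D.al z = j} → Dat A X, ∃ d, Infinite (f ⁻¹' {d}))
    (φ : D.G Set.univ →ₗ[R] Q) (hφ : ∀ x, φ x ∈ D.G Set.univ) (b : X →₀ A) (x0 : X)
    (hb : b x0 = 1) : ∃ a : A, φ ⟨D.cs b, D.cs_mem _ _⟩ = a • D.cs b := by
  obtain ⟨j, rfl⟩ := D.g_surj b
  obtain ⟨m, hm⟩ := D.close_lemma hpig φ hφ j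
  obtain ⟨m', a, ha⟩ := D.span_lemma _ (D.smul_memG _ (D.p ^ m) _ (hφ _)) _ x0 hb hm
  rw [← mul_smul, ← pow_add, ← map_smul D.cs] at ha
  obtain ⟨b', hb'⟩ := D.cs_divN _ _ _ ha
  have e := DFunLike.congr_fun hb' x0
  simp only [Finsupp.smul_apply, smul_eq_mul, hb, mul_one] at e
  refine ⟨b' x0, D.tfN' (m' + m) _ _ ?_⟩
  rw [ha, e, map_smul, smul_assoc]

theorem scalar_lemma [Infinite X] (ψ : (X →₀ A) →+ Q)
    (h : ∀ b x, b x = 1 → ∃ a : A, ψ b = a • D.cs b) : ∃ a : A, ∀ b, ψ b = a • D.cs b := by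
  classical
  obtain ⟨x0⟩ : Nonempty X := inferInstance
  obtain ⟨a0, ha0⟩ := h (Finsupp.single x0 1) x0 (by simp)
  have hx : ∀ x, ψ (Finsupp.single x 1) = a0 • D.cs (Finsupp.single x 1) := by
    intro x
    by_cases hxx : x = x0
    · rw [hxx, ha0]
    · obtain ⟨a, ha⟩ := h (Finsupp.single x 1) x (by simp)
      obtain ⟨c, hc⟩ := h (Finsupp.single x 1 + Finsupp.single x0 1) x (by
        simp [Finsupp.single_apply, Ne.symm hxx])
      rw [map_add, ha, ha0, ← map_smul, ← map_smul, ← map_smul, ← map_add] at hc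
      have e := D.cs_inj' hc
      have e1 := DFunLike.congr_fun e x
      have e2 := DFunLike.congr_fun e x0
      simp [Finsupp.single_apply, hxx, Ne.symm hxx] at e1 e2
      rw [ha, e1, e2]
  have key : ∀ b : X →₀ A, ∀ x, b x = 0 → ∃ c : A,
      ψ b = D.cs (c • b + (c - a0) • Finsupp.single x 1) := by
    intro b x hbx
    obtain ⟨c, hc⟩ := h (b + Finsupp.single x 1) x (by simp [hbx])
    refine ⟨c, ?_⟩
    rw [map_add, hx] at hc
    rw [eq_sub_of_add_eq hc]
    rw [map_add D.cs, map_add D.cs, map_smul, map_smul, smul_add, sub_smul]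
    abel
  refine ⟨a0, fun b => ?_⟩
  obtain ⟨x, hx1⟩ := Infinite.exists_notMem_finset b.support
  obtain ⟨x', hx2⟩ := Infinite.exists_notMem_finset (insert x b.support)
  rw [Finset.mem_insert, not_or] at hx2
  have hbx : b x = 0 := by simpa using hx1
  have hbx' : b x' = 0 := by simpa using hx2.2
  obtain ⟨c, hc⟩ := key b x hbx
  obtain ⟨c', hc'⟩ := key b x' hbx'
  have e := DFunLike.congr_fun (D.cs_inj' (hc.symm.trans hc')) x
  simp [Finsupp.single_apply, hbx, hx2.1] at e
  rw [hc, sub_eq_zero.mp e]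
  simp

theorem end_lemma [Infinite X]
    (hpig : ∀ j, ∀ f : {z // D.al z = j} → Dat A X, ∃ d, Infinite (f ⁻¹' {d}))
    (φ : D.G Set.univ →ₗ[R] D.G Set.univ) : ∃! a : A, ∀ x, φ x = a • x := by
  let φ' : D.G Set.univ →ₗ[R] Q :=
    { toFun := fun x => (φ x : Q)
      map_add' := fun x y => by rw [map_add]; rfl
      map_smul' := fun r x => by rw [map_smul]; rfl }
  let ψ : (X →₀ A) →+ Q :=
    { toFun := fun b => (φ ⟨D.cs b, D.cs_mem _ _⟩ : Q)
      map_zero' := by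
        have : (⟨D.cs 0, D.cs_mem _ _⟩ : D.G Set.univ) = 0 := Subtype.ext (map_zero D.cs)
        rw [this, map_zero]; rfl
      map_add' := fun b c => by
        have : (⟨D.cs (b + c), D.cs_mem _ _⟩ : D.G Set.univ) =
          ⟨D.cs b, D.cs_mem _ _⟩ + ⟨D.cs c, D.cs_mem _ _⟩ := Subtype.ext (map_add D.cs b c)
        rw [this, map_add]; rfl }
  obtain ⟨a, ha⟩ := D.scalar_lemma ψ (fun b x hb => D.eig_lemma hpig φ' (fun x => (φ x).2) b x hb)
  refine ⟨a, fun x => ?_, fun a' ha' => ?_⟩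
  · apply Subtype.ext
    obtain ⟨m, b, C, hC⟩ := D.mem_rep _ x.1 x.2
    rw [← sub_eq_zero]
    refine D.tfN m _ (D.haus _ fun N => ?_)
    let q : D.G Set.univ := ∑ z ∈ C.support, C z • ⟨D.y z N, D.y_mem _ _ (Set.mem_univ _) _⟩
    let b' := b + ∑ z ∈ C.support, C z • D.part z N
    have hx : D.p ^ m • x = ⟨D.cs b', D.cs_mem _ _⟩ + D.p ^ (N * (N + 1)) • q := by
      apply Subtype.ext
      have e1 : ((D.p ^ m • x : D.G Set.univ) : Q) = D.p ^ m • (x : Q) := rfl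
      have e2 : ((q : D.G Set.univ) : Q) = ∑ z ∈ C.support, C z • D.y z N := by
        simp [q]
      have e3 : ((⟨D.cs b', D.cs_mem _ _⟩ + D.p ^ (N * (N + 1)) • q : D.G Set.univ) : Q) =
        D.cs b' + D.p ^ (N * (N + 1)) • (q : Q) := rfl
      rw [e1, e3, e2, hC, Finsupp.sum, map_add, map_sum, add_assoc, Finset.smul_sum,
        ← Finset.sum_add_distrib]
      congr 1
      refine Finset.sum_congr rfl fun z _ => ?_
      rw [map_smul, ← smul_comm', ← smul_add, ← D.y_part]
    have h1 := congrArg (fun x => (φ x : Q)) hx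
    have h2 := congrArg (fun x : D.G Set.univ => a • (x : Q)) hx
    simp only [map_add, map_smul] at h1
    have h1' : D.p ^ m • (φ x : Q) = a • D.cs b' + D.p ^ (N * (N + 1)) • (φ q : Q) := by
      rw [← ha]; exact h1
    have h2' : D.p ^ m • (a • (x : Q)) = a • D.cs b' + D.p ^ (N * (N + 1)) • (a • (q : Q)) := by
      rw [← smul_comm', ← smul_comm', ← smul_add]; exact h2
    refine ⟨D.p ^ (N * (N + 1) - N) • ((φ q : Q) - a • (q : Q)), ?_⟩
    rw [← mul_smul (D.p ^ N), ← pow_add, Nat.add_sub_cancel' (by nlinarith)]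
    have e4 : ((a • x : D.G Set.univ) : Q) = a • (x : Q) := rfl
    rw [e4, smul_sub, h1', h2', smul_sub]
    abel
  · obtain ⟨x0⟩ : Nonempty X := inferInstance
    have h1 : a' • D.cs (Finsupp.single x0 1) = a • D.cs (Finsupp.single x0 1) := by
      rw [← ha]
      exact (congrArg Subtype.val (ha' ⟨D.cs (Finsupp.single x0 1), D.cs_mem _ _⟩)).symm
    rw [← map_smul, ← map_smul] at h1
    simpa using DFunLike.congr_fun (D.cs_inj' h1) x0

theorem y_inj [Nontrivial A] : Function.Injective (fun z => D.y z 0) := by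
  classical
  intro z w hzw
  by_contra hne
  have hzw : D.y z 0 = D.y w 0 := hzw
  obtain ⟨n0, hn0⟩ := D.node_sep z w hne
  obtain ⟨n1, hn1⟩ := D.len_bound (D.g (D.al z))
  obtain ⟨n2, hn2⟩ := D.len_bound (D.g (D.al w))
  refine one_ne_zero (α := A) (D.hausA _ fun N => ?_)
  obtain ⟨n, hn⟩ : ∃ n, n = N + n0 + n1 + n2 := ⟨_, rfl⟩
  have hlen := D.len_node z n
  obtain ⟨a, ha⟩ := D.dvd_coeff (ι := Bool) (fun i => cond i 1 (-1)) (fun i => cond i z w) 0 n true 0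
    (by simp [hzw]) rfl (by
      rintro (_ | _)
      · exact hn2 _ (by simp only [cond_true]; omega)
      · exact hn1 _ (by simp only [cond_true]; omega)) (by
      rintro (_ | _) hi he
      · exact hn0 (D.node_mono z w n0 n (by omega) he.symm)
      · exact hi rfl)
  refine ⟨D.p ^ (n + 1 - N) • a, ?_⟩
  rw [← mul_smul, ← pow_add, Nat.add_sub_cancel' (by omega)]
  exact ha

theorem G_inj : ∃ f : D.G Set.univ → ℕ × (X →₀ A) × (Z →₀ A), Function.Injective f := by
  choose m b C h using fun x : D.G Set.univ => D.mem_rep _ x.1 x.2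
  refine ⟨fun x => (m x, b x, C x), fun x x' hx => ?_⟩
  simp only [Prod.mk.injEq] at hx
  apply Subtype.ext
  apply D.tfN' (m x)
  rw [h x, hx.1, h x', hx.2.1, hx.2.2]

end GSData

theorem GS_smul_comm {R A Q : Type} [CommRing R] [Ring A] [Algebra R A]
    [AddCommGroup Q] [Module R Q] [Module A Q] [IsScalarTower R A Q]
    (r : R) (a : A) (q : Q) : a • r • q = r • a • q := by
  rw [← algebraMap_smul A r q, ← algebraMap_smul A r (a • q), ← mul_smul, ← mul_smul,
    Algebra.commutes]

/-- Sequences which are eventually divisible by every power of `p`. -/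
def GSNull {R : Type} (A : Type) {B : Type} [CommRing R] [Ring A] [Algebra R A]
    [AddCommGroup B] [Module R B] [Module A B] [IsScalarTower R A B] (p : R) :
    Submodule A (ℕ → B) where
  carrier := {f | ∀ k : ℕ, ∃ n0 : ℕ, ∀ n, n0 ≤ n → ∃ c, f n = p ^ k • c}
  add_mem' := by
    intro f f' hf hf' k
    obtain ⟨n0, h0⟩ := hf k
    obtain ⟨n1, h1⟩ := hf' k
    refine ⟨n0 + n1, fun n hn => ?_⟩
    obtain ⟨c, hc⟩ := h0 n (by omega)
    obtain ⟨c', hc'⟩ := h1 n (by omega)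
    exact ⟨c + c', by rw [Pi.add_apply, hc, hc', smul_add]⟩
  zero_mem' := fun k => ⟨0, fun n _ => ⟨0, by simp⟩⟩
  smul_mem' := by
    intro a f hf k
    obtain ⟨n0, h0⟩ := hf k
    refine ⟨n0, fun n hn => ?_⟩
    obtain ⟨c, hc⟩ := h0 n hn
    exact ⟨a • c, by rw [Pi.smul_apply, hc, GS_smul_comm]⟩

/-- Truncated sums. -/
def GSTrunc {R B : Type} [CommRing R] [AddCommGroup B] [Module R B] (p : R) (s : ℕ → B) :
    ℕ → ℕ → B
  | 0, _ => 0
  | k + 1, n => s n + p ^ (2 * (n + 1)) • GSTrunc p s k (n + 1)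

theorem GS_exists_Q {R A B : Type} [CommRing R] [Ring A] [Algebra R A]
    [AddCommGroup B] [Module R B] [Module A B] [IsScalarTower R A B] (p : R)
    (htf : ∀ b : B, p • b = 0 → b = 0) :
    ∃ (Q : Type) (_ : AddCommGroup Q) (_ : Module R Q) (_ : Module A Q)
      (_ : IsScalarTower R A Q) (cs : B →ₗ[A] Q),
      (∀ q : Q, p • q = 0 → q = 0) ∧
      (∀ (q : Q) b, p • q = cs b → ∃ b', b = p • b') ∧
      (∀ q : Q, (∀ N : ℕ, ∃ q', q = p ^ N • q') → q = 0) ∧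
      (∀ s : ℕ → B, ∃ y : ℕ → Q, ∀ n, y n = cs (s n) + p ^ (2 * (n + 1)) • y (n + 1)) := by
  let S : Submodule A (ℕ → B) := GSNull A p
  have hmem : ∀ f : ℕ → B, f ∈ S ↔ ∀ k : ℕ, ∃ n0 : ℕ, ∀ n, n0 ≤ n → ∃ c, f n = p ^ k • c :=
    fun f => Iff.rfl
  have hsm : ∀ (r : R) (f : ℕ → B), S.mkQ (r • f) = r • S.mkQ f := fun r f => rfl
  have hz : ∀ f, S.mkQ f = 0 ↔ f ∈ S := fun f => Submodule.Quotient.mk_eq_zero S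
  have hsurj : ∀ q, ∃ f, S.mkQ f = q := Submodule.mkQ_surjective S
  let cst : B →ₗ[A] (ℕ → B) :=
    { toFun := fun b _ => b, map_add' := fun _ _ => rfl, map_smul' := fun _ _ => rfl }
  refine ⟨(ℕ → B) ⧸ S, inferInstance, inferInstance, inferInstance, inferInstance,
    S.mkQ ∘ₗ cst, ?_, ?_, ?_, ?_⟩
  · intro q hq
    obtain ⟨f, rfl⟩ := hsurj q
    rw [← hsm, hz, hmem] at hq
    rw [hz, hmem]
    intro k
    obtain ⟨n0, h0⟩ := hq (k + 1)
    refine ⟨n0, fun n hn => ?_⟩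
    obtain ⟨c, hc⟩ := h0 n hn
    refine ⟨c, sub_eq_zero.mp (htf _ ?_)⟩
    rw [smul_sub, ← mul_smul p (p ^ k), ← pow_succ', ← hc, Pi.smul_apply, sub_self]
  · intro q b hq
    obtain ⟨f, rfl⟩ := hsurj q
    rw [← hsm, LinearMap.comp_apply, ← sub_eq_zero, ← map_sub, hz, hmem] at hq
    obtain ⟨n0, h0⟩ := hq 1
    obtain ⟨c, hc⟩ := h0 n0 le_rfl
    refine ⟨f n0 - c, ?_⟩
    have hc' : p • f n0 - b = p ^ 1 • c := hc
    rw [pow_one] at hc'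
    rw [smul_sub, ← hc']
    abel
  · intro q hq
    obtain ⟨f, rfl⟩ := hsurj q
    rw [hz, hmem]
    intro k
    obtain ⟨q', hq'⟩ := hq k
    obtain ⟨f', rfl⟩ := hsurj q'
    rw [← hsm, ← sub_eq_zero, ← map_sub, hz, hmem] at hq'
    obtain ⟨n0, h0⟩ := hq' k
    refine ⟨n0, fun n hn => ?_⟩
    obtain ⟨c, hc⟩ := h0 n hn
    have hc' : f n - p ^ k • f' n = p ^ k • c := hc
    refine ⟨c + f' n, ?_⟩
    rw [smul_add, ← hc']
    abel
  · intro s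
    refine ⟨fun n => S.mkQ (fun N => GSTrunc p s (N - n) n), fun n => ?_⟩
    rw [← hsm, LinearMap.comp_apply, ← map_add, ← sub_eq_zero, ← map_sub, hz, hmem]
    intro k
    refine ⟨n + 1, fun N hN => ⟨0, ?_⟩⟩
    obtain ⟨d, rfl⟩ := Nat.exists_eq_add_of_le hN
    have e1 : n + 1 + d - n = d + 1 := by omega
    have e2 : n + 1 + d - (n + 1) = d := by omega
    change GSTrunc p s (n + 1 + d - n) n -
      (s n + p ^ (2 * (n + 1)) • GSTrunc p s (n + 1 + d - (n + 1)) (n + 1)) = _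
    rw [e1, e2, GSTrunc, sub_self, smul_zero]

theorem GS_freeA {R A : Type} [CommRing R] [IsDomain R] [IsPrincipalIdealRing R] [Ring A]
    [Algebra R A] [Module.Free R A] (p : R) (hp : p ≠ 0) (hu : ¬ IsUnit p) :
    (∀ a : A, p • a = 0 → a = 0) ∧ (∀ a : A, (∀ N : ℕ, ∃ a', a = p ^ N • a') → a = 0) := by
  refine ⟨fun a ha => ?_, fun a ha => ?_⟩
  · exact (smul_eq_zero.mp ha).resolve_left hp
  · let b := Module.Free.chooseBasis R A
    apply b.repr.injective
    rw [map_zero]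
    ext i
    rw [Finsupp.zero_apply]
    by_contra hne
    have hf : FiniteMultiplicity p (b.repr a i) := FiniteMultiplicity.of_not_isUnit hu hne
    obtain ⟨n, hn⟩ := hf
    obtain ⟨a', ha'⟩ := ha (n + 1)
    exact hn ⟨b.repr a' i, by rw [ha', map_smul, Finsupp.smul_apply, smul_eq_mul]⟩

/-- Initial segments of a 0-1 sequence. -/
def GSpre (f : ℕ → Bool) (n : ℕ) : List Bool := (List.range n).map f

theorem GSpre_len (f : ℕ → Bool) (n : ℕ) : (GSpre f n).length = n := by simp [GSpre]

theorem GSpre_eq (f h : ℕ → Bool) (n : ℕ) : GSpre f n = GSpre h n ↔ ∀ i, i < n → f i = h i := by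
  simp [GSpre]

/-- Branches. -/
noncomputable def GSep {J : Type} (io : J → ℕ → Bool) (j : J) (v : ℕ → Bool) (l : ℕ) : Bool :=
  haveI := Classical.propDecidable (∃ k, l = Encodable.encode (GSpre (io j) k) ∧ v k = true)
  decide (∃ k, l = Encodable.encode (GSpre (io j) k) ∧ v k = true)

theorem GSpre_enc {f h : ℕ → Bool} {k k' : ℕ}
    (e : Encodable.encode (GSpre f k) = Encodable.encode (GSpre h k')) :
    k = k' ∧ ∀ i, i < k → f i = h i := by
  have e' := Encodable.encode_injective e
  have hk : k = k' := by rw [← GSpre_len f k, e', GSpre_len]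
  subst hk
  exact ⟨rfl, (GSpre_eq _ _ _).mp e'⟩

theorem GSep_enc {J : Type} (io : J → ℕ → Bool) (j : J) (v : ℕ → Bool) (k : ℕ) :
    GSep io j v (Encodable.encode (GSpre (io j) k)) = v k := by
  rw [Bool.eq_iff_iff]
  unfold GSep
  simp only [decide_eq_true_eq]
  constructor
  · rintro ⟨k', h1, h2⟩
    rwa [(GSpre_enc h1).1]
  · exact fun h => ⟨k, rfl, h⟩

theorem GSep_S {J : Type} (io : J → ℕ → Bool) (j : J) (v v' : ℕ → Bool) (l : ℕ)
    (h : GSep io j v l ≠ GSep io j v' l) : ∃ k, l = Encodable.encode (GSpre (io j) k) := by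
  by_contra hcon
  apply h
  have : ∀ v, GSep io j v l = false := by
    intro v
    rw [GSep, decide_eq_false_iff_not]
    rintro ⟨k, hk, -⟩
    exact hcon ⟨k, hk⟩
  rw [this, this]

theorem GS_exists_data {R A : Type} [CommRing R] [IsDomain R] [IsPrincipalIdealRing R] [Ring A]
    [Algebra R A] [Module.Free R A] (p : R) (hp : p ≠ 0) (hu : ¬ IsUnit p)
    (io : A → ℕ → Bool) (hio : Function.Injective io) (V : Set (ℕ → Bool))
    (g : A → ((A × List Bool) →₀ A)) (hg : Function.Surjective g) :
    ∃ (Q : Type) (_ : AddCommGroup Q) (_ : Module R Q) (_ : Module A Q)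
      (_ : IsScalarTower R A Q) (D : GSData R A A (A × List Bool) (A × V) Q), D.al = Prod.fst := by
  obtain ⟨htA, hhA⟩ := GS_freeA (A := A) p hp hu
  obtain ⟨Q, i1, i2, i3, i4, cs, h1, h2, h3, h4⟩ :=
    GS_exists_Q (A := A) (B := (A × List Bool) →₀ A) p (by
      intro b hb
      ext x
      exact htA _ (by simpa using DFunLike.congr_fun hb x))
  let ep : A × V → ℕ → Bool := fun z => GSep io z.1 z.2.1
  let node : A × V → ℕ → A × List Bool := fun z n => (z.1, GSpre (ep z) n)
  have hnode : ∀ z w n, node z n = node w n ↔ z.1 = w.1 ∧ ∀ i, i < n → ep z i = ep w i := by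
    intro z w n
    rw [← GSpre_eq]
    exact Prod.mk_inj
  have hy := fun z : A × V => h4 (fun n => Finsupp.single (node z n) 1 +
    p ^ (n + 1) • (if ep z n then g z.1 else 0))
  choose y hy using hy
  refine ⟨Q, i1, i2, i3, i4,
    { p := p
      node := node
      len := fun x => x.2.length
      al := Prod.fst
      ep := ep
      S := fun j => {l | ∃ k, l = Encodable.encode (GSpre (io j) k)}
      g := g
      cs := cs
      y := y
      len_node := fun z n => GSpre_len _ _
      node_al := fun z w n h => ((hnode z w n).mp h).1
      node_mono := fun z w m n hmn h => (hnode z w m).mpr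
        ⟨((hnode z w n).mp h).1, fun i hi => ((hnode z w n).mp h).2 i (by omega)⟩
      node_sep := ?_
      node_succ := ?_
      node_ep := fun z w n h => ((hnode z w _).mp h).2 n (by omega)
      node_S := ?_
      S_fin := ?_
      node_fin := ?_
      g_surj := hg
      y_eq := ?_
      tf := h1
      tfA := htA
      cs_div := h2
      haus := h3
      hausA := hhA }, rfl⟩
  · intro z w hne
    by_cases hz : z.1 = w.1
    · have hv : z.2.1 ≠ w.2.1 := fun h => hne (Prod.ext hz (Subtype.ext h))
      obtain ⟨k, hk⟩ := Function.ne_iff.mp hv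
      refine ⟨Encodable.encode (GSpre (io z.1) k) + 1, fun h => hk ?_⟩
      have := ((hnode _ _ _).mp h).2 _ (Nat.lt_succ_self _)
      simp only [ep] at this
      rwa [← hz, GSep_enc, GSep_enc] at this
    · exact ⟨0, fun h => hz ((hnode _ _ _).mp h).1⟩
  · intro z w n h he
    refine (hnode _ _ _).mpr ⟨((hnode _ _ _).mp h).1, fun i hi => ?_⟩
    rcases Nat.lt_succ_iff_lt_or_eq.mp hi with hi | rfl
    · exact ((hnode _ _ _).mp h).2 i hi
    · exact he
  · intro z w n hz he
    apply GSep_S io z.1 z.2.1 w.2.1 n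
    simp only [ep] at he
    rwa [← hz] at he
  · intro i j hij
    obtain ⟨k0, hk0⟩ := Function.ne_iff.mp (hio.ne hij)
    refine ((Set.finite_Iic k0).image (fun k => Encodable.encode (GSpre (io i) k))).subset ?_
    rintro l ⟨⟨k, hk⟩, ⟨k', hk'⟩⟩
    refine ⟨k, ?_, hk.symm⟩
    by_contra hlt
    exact hk0 ((GSpre_enc (hk.symm.trans hk')).2 k0 (not_le.mp hlt))
  · intro j n
    refine ((List.finite_length_eq Bool n).image (fun l => (j, l))).subset ?_
    rintro x ⟨z, rfl, rfl⟩
    exact ⟨GSpre (ep z) n, GSpre_len _ _, rfl⟩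
  · intro z n
    rw [hy z n, map_add, LinearMap.map_smul_of_tower, apply_ite cs, map_zero, two_mul,
      pow_add _ (n + 1) (n + 1),
      mul_smul, smul_add, add_assoc]

theorem GS_infinite {R : Type} [CommRing R] [IsDomain R] (hRnf : ¬ IsField R)
    {A : Type} [Ring A] [Algebra R A] [Module.Free R A] [Nontrivial A] : Infinite A := by
  have hR : Infinite R := by
    rw [← not_finite_iff_infinite]
    intro h
    exact hRnf (Finite.isField_of_domain R)
  exact Infinite.of_injective (algebraMap R A) (FaithfulSMul.algebraMap_injective R A)

theorem GS_card {A : Type} [Ring A] [Nontrivial A] [Infinite A] :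
    Cardinal.mk ((A × List Bool) →₀ A) = Cardinal.mk A ∧
    Cardinal.mk (GSData.Dat A (A × List Bool)) = Cardinal.mk A := by
  have hA : Cardinal.aleph0 ≤ Cardinal.mk A := Cardinal.aleph0_le_mk A
  have hX : Cardinal.mk (A × List Bool) = Cardinal.mk A := by
    rw [Cardinal.mk_prod, Cardinal.lift_id, Cardinal.lift_id,
      Cardinal.mul_eq_left hA ?_ (Cardinal.mk_ne_zero _)]
    exact Cardinal.mk_le_aleph0.trans hA
  have hF : Cardinal.mk ((A × List Bool) →₀ A) = Cardinal.mk A := by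
    rw [Cardinal.mk_finsupp_of_infinite, hX, max_self]
  refine ⟨hF, ?_⟩
  have hS : Cardinal.mk (Σ K : ℕ, (Fin K → A × (A × List Bool))) = Cardinal.mk A := by
    rw [← Cardinal.mk_congr List.equivSigmaTuple, Cardinal.mk_list_eq_mk, Cardinal.mk_prod,
      Cardinal.lift_id, Cardinal.lift_id, hX, Cardinal.mul_eq_self hA]
  have hN : Cardinal.mk ℕ ≤ Cardinal.mk A := by simpa using hA
  simp only [GSData.Dat, Cardinal.mk_prod, Cardinal.lift_id] at *
  rw [hF, hS, Cardinal.mul_eq_self hA, Cardinal.mul_eq_right hA hN (Cardinal.mk_ne_zero _),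
    Cardinal.mul_eq_right hA hN (Cardinal.mk_ne_zero _)]

/-- Main Theorem 3.1: Let `R` be a countable principal ideal
domain which is not a field and `A ≠ 0` an `R`-algebra which is free as an
`R`-module with `|A| < λ ≤ 2^ℵ₀`.  Then there exists an `ℵ₁`-free `R`-module
`G` of cardinality `λ` (every countably generated `R`-submodule of `G` is
free) with `End_R G = A`: `G` is an `A`-module and every `R`-endomorphism of
`G` is scalar multiplication by a unique element of `A`. -/
theorem stmt19 {R : Type} [CommRing R] [IsDomain R] [IsPrincipalIdealRing R]
    [Countable R] (hRnf : ¬ IsField R)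
    {A : Type} [Ring A] [Algebra R A] [Module.Free R A] [Nontrivial A]
    (lam : Cardinal.{0}) (h1 : Cardinal.mk A < lam)
    (h2 : lam ≤ Cardinal.continuum) :
    ∃ (G : Type) (_ : AddCommGroup G) (_ : Module R G) (_ : Module A G)
      (_ : IsScalarTower R A G),
      Cardinal.mk G = lam ∧
      (∀ N : Submodule R G, (∃ S : Set G, S.Countable ∧ N = Submodule.span R S) →
        Module.Free R N) ∧
      ∀ φ : G →ₗ[R] G, ∃! a : A, ∀ x : G, φ x = a • x := by
  haveI hAinf : Infinite A := GS_infinite hRnf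
  obtain ⟨p, hp, hu⟩ := Ring.exists_not_isUnit_of_not_isField hRnf
  have hA : Cardinal.aleph0 ≤ Cardinal.mk A := Cardinal.aleph0_le_mk A
  have hlam : Cardinal.aleph0 ≤ lam := hA.trans h1.le
  obtain ⟨cF, cD⟩ := GS_card (A := A)
  have hc : Cardinal.mk (ℕ → Bool) = Cardinal.continuum := by simp
  have hAc : Cardinal.mk A ≤ Cardinal.mk (ℕ → Bool) := by rw [hc]; exact h1.le.trans h2
  obtain ⟨io⟩ := Cardinal.le_def _ _ |>.mp hAc
  obtain ⟨V, hV⟩ := Cardinal.le_mk_iff_exists_set.mp (h2.trans hc.ge)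
  obtain ⟨g⟩ := Cardinal.eq.mp cF.symm
  obtain ⟨Q, i1, i2, i3, i4, D, hD⟩ :=
    GS_exists_data (R := R) (A := A) p hp hu io io.injective V g g.surjective
  have hpig : ∀ j, ∀ f : {z // D.al z = j} → GSData.Dat A (A × List Bool),
      ∃ d, Infinite (f ⁻¹' {d}) := by
    intro j f
    haveI : Infinite (GSData.Dat A (A × List Bool)) := by
      rw [Cardinal.infinite_iff, cD]; exact hA
    refine Cardinal.exists_infinite_fiber' f ?_
    rw [cD]
    refine h1.trans_le ?_
    rw [← hV]
    refine Cardinal.mk_le_of_injective (f := fun v : V => (⟨(j, v), by rw [hD]⟩ :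
      {z // D.al z = j})) ?_
    intro v w h
    exact (Prod.mk_inj.mp (congrArg Subtype.val h)).2
  have hZ : Cardinal.mk (A × V) = lam := by
    rw [Cardinal.mk_prod, Cardinal.lift_id, Cardinal.lift_id, hV,
      Cardinal.mul_eq_right hlam h1.le (Cardinal.mk_ne_zero _)]
  haveI hZinf : Infinite (A × V) := by rw [Cardinal.infinite_iff, hZ]; exact hlam
  refine ⟨D.G Set.univ, inferInstance, inferInstance, inferInstance, inferInstance, ?_, ?_, ?_⟩
  · apply le_antisymm
    · obtain ⟨f, hf⟩ := D.G_inj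
      refine (Cardinal.mk_le_of_injective hf).trans ?_
      simp only [Cardinal.mk_prod, Cardinal.lift_id]
      rw [cF, Cardinal.mk_finsupp_of_infinite, hZ, max_eq_left h1.le,
        Cardinal.mul_eq_right hlam h1.le (Cardinal.mk_ne_zero _)]
      exact (Cardinal.mul_eq_right hlam (by simpa using hlam) (Cardinal.mk_ne_zero _)).le
    · rw [← hZ]
      refine Cardinal.mk_le_of_injective
        (f := fun z => (⟨D.y z 0, D.y_mem _ _ (Set.mem_univ _) 0⟩ : D.G Set.univ)) ?_
      intro z w h
      exact D.y_inj (congrArg Subtype.val h)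
  · rintro N ⟨S, hS, hN⟩
    exact D.aleph1_free N S hS hN
  · exact D.end_lemma hpig
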